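/- Let U = (T, G, H) be an itKI_c1-algebra and let D be a centered tense deductive system of U. Then D_{S_D} = D, where S_D := D ∩ C(T) and D_S := {u ∈ T : ∼u⇒c ∈ S and ⊤⇒(u⊔c) ∈ S}. -/

import Mathlib

/-- A tense KI-algebra: a centered Kleene algebra with an implication ⇒
satisfying (KI1)-(KI5), together with tense operators G, H satisfying
(t1)-(t6), where F x := ∼G(∼x) and P x := ∼H(∼x). -/
structure TenseKI (T : Type*) [DistribLattice T] [BoundedOrder T] where
  neg : T → T
  c : T
  imp : T → T → T
  neg_neg : ∀ x : T, neg (neg x) = x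
  neg_sup : ∀ x y : T, neg (x ⊔ y) = neg x ⊓ neg y
  kleene : ∀ x y : T, x ⊓ neg x ≤ y ⊔ neg y
  neg_c : neg c = c
  KI1a : ∀ x y z : T, imp x y ⊓ imp x z = imp x (y ⊓ z)
  KI1b : ∀ x y z : T, imp x z ⊓ imp y z = imp (x ⊔ y) z
  KI1c : ∀ x : T, imp ⊥ x = ⊤
  KI1d : ∀ x : T, imp x ⊤ = ⊤
  KI2 : ∀ x y : T, (x ⊓ imp x y) ⊔ c ≤ y ⊔ c
  KI3 : imp c c = ⊤
  KI4 : ∀ x y : T, imp x y ⊓ c = (neg x ⊔ y) ⊓ c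
  KI5 : ∀ x y : T, imp x (neg y) ⊔ c = imp x (neg y ⊔ c) ⊓ imp y (neg x ⊔ c)
  G : T → T
  H : T → T
  t1G : G ⊤ = ⊤
  t1H : H ⊤ = ⊤
  t2G : ∀ x y : T, G (x ⊓ y) = G x ⊓ G y
  t2H : ∀ x y : T, H (x ⊓ y) = H x ⊓ H y
  t3G : ∀ x : T, x ≤ G (neg (H (neg x)))
  t3H : ∀ x : T, x ≤ H (neg (G (neg x)))
  t4G : ∀ x y : T, G (x ⊔ y) ≤ G x ⊔ neg (G (neg y))
  t4H : ∀ x y : T, H (x ⊔ y) ≤ H x ⊔ neg (H (neg y))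
  t5G : ∀ x y : T, G (imp x y) ≤ imp (G x) (G y)
  t5H : ∀ x y : T, H (imp x y) ≤ imp (H x) (H y)
  t6G : ∀ x y : T, G (imp x y) ≤ imp (neg (G (neg x))) (neg (G (neg y)))
  t6H : ∀ x y : T, H (imp x y) ≤ imp (neg (H (neg x))) (neg (H (neg y)))

/-- F x := ∼G(∼x). -/
def TenseKI.F {T : Type*} [DistribLattice T] [BoundedOrder T] (K : TenseKI T) (x : T) : T :=
  K.neg (K.G (K.neg x))

/-- P x := ∼H(∼x). -/
def TenseKI.P {T : Type*} [DistribLattice T] [BoundedOrder T] (K : TenseKI T) (x : T) : T :=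
  K.neg (K.H (K.neg x))

/-- An itKI_c1-algebra: a tense centered KI-algebra satisfying x ⇒ x = ⊤
and the interpolation condition (CK). -/
structure ItKIc1 (T : Type*) [DistribLattice T] [BoundedOrder T] extends TenseKI T where
  Gc : G c = c
  Hc : H c = c
  imp_self : ∀ x : T, imp x x = ⊤
  CK : ∀ x y : T, c ≤ x → c ≤ y → x ⊓ y ≤ c → ∃ z : T, z ⊔ c = x ∧ neg z ⊔ c = y

section
variable {T : Type*} [DistribLattice T] [BoundedOrder T]

/-- F on an itKI_c1-algebra. -/
abbrev ItKIc1.F (K : ItKIc1 T) : T → T := K.toTenseKI.F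

/-- P on an itKI_c1-algebra. -/
abbrev ItKIc1.P (K : ItKIc1 T) : T → T := K.toTenseKI.P

/-- A congruence of an itKI_c1-algebra: an equivalence relation compatible
with ⊓, ⊔, ⇒, ∼, G, H. -/
def ItKIc1.IsCongrU (K : ItKIc1 T) (ε : T → T → Prop) : Prop :=
  Equivalence ε ∧
  (∀ a b x y : T, ε a b → ε x y →
    ε (a ⊓ x) (b ⊓ y) ∧ ε (a ⊔ x) (b ⊔ y) ∧ ε (K.imp a x) (K.imp b y)) ∧
  (∀ a b : T, ε a b → ε (K.neg a) (K.neg b) ∧ ε (K.G a) (K.G b) ∧ ε (K.H a) (K.H b))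

/-- A tense 1-filter of C(U): a lattice filter S of C(T) = {x : c ≤ x} with
((a⊓f)⇒b)⇒(a⇒b) ∈ S for all a, b ∈ C(T), f ∈ S, closed under G and H. -/
def ItKIc1.IsTense1FilterC (K : ItKIc1 T) (S : Set T) : Prop :=
  (∀ x ∈ S, K.c ≤ x) ∧ S.Nonempty ∧
  (∀ x ∈ S, ∀ y : T, K.c ≤ y → x ≤ y → y ∈ S) ∧
  (∀ x ∈ S, ∀ y ∈ S, x ⊓ y ∈ S) ∧
  (∀ a b : T, K.c ≤ a → K.c ≤ b → ∀ f ∈ S,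
    K.imp (K.imp (a ⊓ f) b) (K.imp a b) ∈ S) ∧
  (∀ x ∈ S, K.G x ∈ S) ∧ (∀ x ∈ S, K.H x ∈ S)

/-- A tense deductive system of U: contains ⊤, closed under modus ponens
and under G and H. -/
def ItKIc1.IsTDS (K : ItKIc1 T) (D : Set T) : Prop :=
  ⊤ ∈ D ∧ (∀ u ∈ D, ∀ v : T, K.imp u v ∈ D → v ∈ D) ∧
  (∀ u ∈ D, K.G u ∈ D ∧ K.H u ∈ D)

/-- A centered tense deductive system: a tense deductive system D such that
(ctD1) D ∩ C(T) is a tense 1-filter of C(U) and (ctD2) ∼u⇒c ∈ D and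
⊤⇒(u⊔c) ∈ D imply u ∈ D. -/
def ItKIc1.IsCTDS (K : ItKIc1 T) (D : Set T) : Prop :=
  K.IsTDS D ∧ K.IsTense1FilterC (D ∩ {x | K.c ≤ x}) ∧
  (∀ u : T, K.imp (K.neg u) K.c ∈ D → K.imp ⊤ (u ⊔ K.c) ∈ D → u ∈ D)

end

section
variable {T : Type*} [DistribLattice T] [BoundedOrder T]

theorem ItKIc1.imp_eq_top_of_le (K : ItKIc1 T) {x y : T} (h : x ≤ y) : K.imp x y = ⊤ := by
  have hxy := K.KI1a x x y
  rw [inf_eq_left.mpr h, K.imp_self, top_inf_eq] at hxy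
  exact hxy

theorem ItKIc1.IsTDS.mem_of_le {K : ItKIc1 T} {D : Set T} (hD : K.IsTDS D) {x y : T}
    (hx : x ∈ D) (h : x ≤ y) : y ∈ D :=
  hD.2.1 x hx y (K.imp_eq_top_of_le h ▸ hD.1)

theorem TenseKI.c_le_imp (K : TenseKI T) {x y : T} (hy : K.c ≤ y) : K.c ≤ K.imp x y := by
  have h := K.KI4 x y
  rw [inf_eq_right.mpr (le_sup_of_le_right hy)] at h
  exact inf_eq_right.mp h

theorem TenseKI.neg_sup_c_imp_c (K : TenseKI T) (u : T) :
    K.imp (K.neg u ⊔ K.c) K.c = K.imp (K.neg u) K.c := by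
  rw [← K.KI1b, K.KI3, inf_top_eq]

theorem TenseKI.neg_sup_c_inf_sup_c (K : TenseKI T) (u : T) :
    (K.neg u ⊔ K.c) ⊓ (u ⊔ K.c) = K.c := by
  have h := K.kleene u K.c
  rw [K.neg_c, sup_idem, inf_comm] at h
  rw [← sup_inf_right, sup_eq_right.mpr h]

end

/-- For a centered tense deductive system D of U, D_{S_D} = D, where
S_D = D ∩ C(T) and D_S = {u : ∼u⇒c ∈ S and ⊤⇒(u⊔c) ∈ S}. -/
theorem stmt16 {T : Type*} [DistribLattice T] [BoundedOrder T] (K : ItKIc1 T)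
    (D : Set T) (hD : K.IsCTDS D) :
    {u : T | K.imp (K.neg u) K.c ∈ D ∩ {x | K.c ≤ x} ∧
             K.imp ⊤ (u ⊔ K.c) ∈ D ∩ {x | K.c ≤ x}} = D := by
  obtain ⟨hT, ⟨-, -, -, -, hF, -⟩, hc⟩ := hD
  ext u
  refine ⟨fun h => hc u h.1.1 h.2.1, fun hu => ?_⟩
  have hf : u ⊔ K.c ∈ D ∩ {x | K.c ≤ x} := ⟨hT.mem_of_le hu le_sup_left, le_sup_right⟩
  refine ⟨⟨?_, K.c_le_imp le_rfl⟩, ⟨?_, K.c_le_imp le_sup_right⟩⟩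
  · have h := (hF (K.neg u ⊔ K.c) K.c le_sup_right le_rfl _ hf).1
    rw [K.neg_sup_c_inf_sup_c, K.imp_self, K.neg_sup_c_imp_c] at h
    exact hT.2.1 ⊤ hT.1 _ h
  · have h := (hF ⊤ (u ⊔ K.c) le_top le_sup_right _ hf).1
    rw [top_inf_eq, K.imp_self] at h
    exact hT.2.1 ⊤ hT.1 _ h
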